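/- arXiv:1909.09257 — 3 statements merged into one kernel-verified Lean document; each statement's English description precedes it below -/
import Mathlib

section
/- Let p ≥ 2 be a real number, n ≥ 1 an integer, and let μ be a probability measure on ℝ admitting a density f with respect to Lebesgue measure such that f is log-concave (f(tx + (1−t)y) ≥ f(x)^t f(y)^{1−t} for all x, y ∈ ℝ and t ∈ [0,1]) and f is supported in a compact interval [0, K̄] with K̄ > 0. Then the quantization problem min over K_1 ≤ K_2 ≤ ... ≤ K_n of ∫_ℝ min_{1≤j≤n} |x − K_j|^p μ(dx) admits a unique solution, and this solution is non-degenerate, i.e. it satisfies K_1 < K_2 < ... < K_n. -/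
open MeasureTheory

namespace Quant

structure QData (f : ℝ → ℝ) (Kbar : ℝ) (μ : Measure ℝ) : Prop where
  nn : ∀ x, 0 ≤ f x
  lc : ∀ x y t : ℝ, 0 ≤ t → t ≤ 1 → f x ^ t * f y ^ (1 - t) ≤ f (t * x + (1 - t) * y)
  kpos : 0 < Kbar
  supp : ∀ x : ℝ, x ∉ Set.Icc (0 : ℝ) Kbar → f x = 0
  dens : μ = volume.withDensity fun x => ENNReal.ofReal (f x)
  prob : IsProbabilityMeasure μ

variable {f : ℝ → ℝ} {Kbar : ℝ} {μ : Measure ℝ}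

lemma QData.min_le (h : QData f Kbar μ) {x y z : ℝ} (hx : x ≤ z) (hy : z ≤ y) :
    min (f x) (f y) ≤ f z := by
  rcases eq_or_lt_of_le (hx.trans hy) with e | hlt
  · have : z = x := le_antisymm (by linarith) hx
    rw [this]; exact min_le_left _ _
  have hd : 0 < y - x := by linarith
  set t := (y - z) / (y - x) with ht
  have ht0 : 0 ≤ t := div_nonneg (by linarith) hd.le
  have ht1 : t ≤ 1 := by rw [ht, div_le_one hd]; linarith
  have hz : t * x + (1 - t) * y = z := by rw [ht]; field_simp; ring
  have h1 := h.lc x y t ht0 ht1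
  rw [hz] at h1
  set m := min (f x) (f y) with hm
  have hm0 : 0 ≤ m := le_min (h.nn x) (h.nn y)
  rcases eq_or_lt_of_le hm0 with e | hmp
  · rw [← e]; exact h.nn z
  calc m = m ^ t * m ^ (1 - t) := by
        rw [← Real.rpow_add hmp]; simp
    _ ≤ f x ^ t * f y ^ (1 - t) := by
        apply mul_le_mul
        · exact Real.rpow_le_rpow hm0 (min_le_left _ _) ht0
        · exact Real.rpow_le_rpow hm0 (min_le_right _ _) (by linarith)
        · exact Real.rpow_nonneg hm0 _
        · exact Real.rpow_nonneg (h.nn x) _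
    _ ≤ f z := h1

lemma QData.pos_between (h : QData f Kbar μ) {x y z : ℝ} (hx : x ≤ z) (hy : z ≤ y)
    (fx : 0 < f x) (fy : 0 < f y) : 0 < f z :=
  lt_of_lt_of_le (lt_min fx fy) (h.min_le hx hy)

lemma QData.meas (h : QData f Kbar μ) : Measurable f := by
  apply measurable_of_Ioi
  intro c
  apply Set.OrdConnected.measurableSet
  refine ⟨fun x hx y hy z hz => ?_⟩
  exact lt_of_lt_of_le (lt_min hx hy) (h.min_le hz.1 hz.2)

lemma QData.meas' (h : QData f Kbar μ) : Measurable (fun x => ENNReal.ofReal (f x)) :=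
  h.meas.ennreal_ofReal

/-- log-concavity in the monotone likelihood ratio form -/
lemma QData.mlr (h : QData f Kbar μ) {a x D : ℝ} (hax : a ≤ x) (hD : 0 < D) :
    f (x + D) * f a ≤ f x * f (a + D) := by
  have hd : 0 < x - a + D := by linarith
  set t := D / (x - a + D) with ht
  have ht0 : 0 < t := div_pos hD hd
  have ht1 : t ≤ 1 := by rw [ht, div_le_one hd]; linarith
  have e1 : t * a + (1 - t) * (x + D) = x := by rw [ht]; field_simp; ring
  have e2 : t * (x + D) + (1 - t) * a = a + D := by rw [ht]; field_simp; ring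
  have h1 := h.lc a (x + D) t ht0.le ht1
  have h2 := h.lc (x + D) a t ht0.le ht1
  rw [e1] at h1
  rw [e2] at h2
  have key : ∀ u : ℝ, 0 ≤ u → u ^ t * u ^ (1 - t) = u := by
    intro u hu
    rw [← Real.rpow_add' hu (by simp)]; simp
  calc f (x + D) * f a
      = (f (x + D) ^ t * f (x + D) ^ (1 - t)) * (f a ^ t * f a ^ (1 - t)) := by
        rw [key _ (h.nn _), key _ (h.nn _)]
    _ = (f a ^ t * f (x + D) ^ (1 - t)) * (f (x + D) ^ t * f a ^ (1 - t)) := by ring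
    _ ≤ f x * f (a + D) := by
        apply mul_le_mul h1 h2 _ (h.nn _)
        exact mul_nonneg (Real.rpow_nonneg (h.nn _) _) (Real.rpow_nonneg (h.nn _) _)

lemma QData.ae_pos (h : QData f Kbar μ) : ∀ᵐ x ∂μ, 0 < f x := by
  rw [ae_iff, h.dens, withDensity_apply_eq_zero h.meas']
  convert measure_empty (μ := (volume : Measure ℝ))
  ext x
  simp

lemma QData.ae_mem (h : QData f Kbar μ) : ∀ᵐ x ∂μ, x ∈ Set.Icc (0 : ℝ) Kbar := by
  filter_upwards [h.ae_pos] with x hx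
  by_contra hc
  rw [h.supp x hc] at hx
  exact lt_irrefl _ hx

lemma QData.ac (h : QData f Kbar μ) : μ ≪ volume := by
  rw [h.dens]; exact withDensity_absolutelyContinuous _ _

lemma QData.ae_ne (h : QData f Kbar μ) (a : ℝ) : ∀ᵐ x ∂μ, x ≠ a :=
  h.ac.ae_le (Measure.ae_ne volume a)

lemma QData.open_pos (h : QData f Kbar μ) {O : Set ℝ} (hO : IsOpen O) (hne : O.Nonempty)
    (hf : ∀ x ∈ O, 0 < f x) : μ O ≠ 0 := by
  rw [h.dens, Ne, withDensity_apply_eq_zero h.meas']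
  have : {x | ENNReal.ofReal (f x) ≠ 0} ∩ O = O := by
    ext x
    simp only [Set.mem_inter_iff, Set.mem_ofPred_eq, and_iff_right_iff_imp]
    intro hx
    simpa using hf x hx
  rw [this]
  exact (hO.measure_pos volume hne).ne'

lemma QData.exists_two (h : QData f Kbar μ) : ∃ u v, u < v ∧ 0 < f u ∧ 0 < f v := by
  have := h.prob
  obtain ⟨u, hu⟩ := h.ae_pos.exists
  obtain ⟨v, hv, hvu⟩ := (h.ae_pos.and (h.ae_ne u)).exists
  rcases lt_or_gt_of_ne hvu with h1 | h1
  · exact ⟨v, u, h1, hv, hu⟩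
  · exact ⟨u, v, h1, hu, hv⟩

lemma QData.integrable (h : QData f Kbar μ) {g : ℝ → ℝ} (hg : Measurable g) (M : ℝ)
    (hM : ∀ x ∈ Set.Icc (0 : ℝ) Kbar, |g x| ≤ M) : Integrable g μ := by
  have := h.prob
  apply Integrable.of_bound hg.aestronglyMeasurable M
  filter_upwards [h.ae_mem] with x hx
  exact hM x hx

lemma QData.integrable_cont (h : QData f Kbar μ) {g : ℝ → ℝ} (hg : Continuous g) :
    Integrable g μ := by
  obtain ⟨M, hM⟩ := (isCompact_Icc (a := (0 : ℝ)) (b := Kbar)).exists_bound_of_continuousOn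
    hg.continuousOn
  exact h.integrable hg.measurable M hM

lemma ae_zero {ν : Measure ℝ} {g : ℝ → ℝ} (hi : Integrable g ν) (h0 : ∫ x, g x ∂ν = 0)
    (hn : 0 ≤ᵐ[ν] g) : g =ᵐ[ν] 0 :=
  (integral_eq_zero_iff_of_nonneg_ae hn hi).1 h0

variable {n : ℕ}

/-- the integrand -/
noncomputable def mfun (p : ℝ) (K : Fin n → ℝ) (x : ℝ) : ℝ := ⨅ j : Fin n, |x - K j| ^ p

lemma mfun_le (p : ℝ) (K : Fin n → ℝ) (x : ℝ) (j : Fin n) : mfun p K x ≤ |x - K j| ^ p :=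
  ciInf_le (Set.finite_range _).bddBelow j

lemma mfun_exists [NeZero n] (p : ℝ) (K : Fin n → ℝ) (x : ℝ) :
    ∃ j, |x - K j| ^ p = mfun p K x := by
  have : Nonempty (Fin n) := ⟨0⟩
  exact exists_eq_ciInf_of_finite

lemma mfun_cont [NeZero n] {p : ℝ} (hp : 2 ≤ p) :
    Continuous (fun q : (Fin n → ℝ) × ℝ => mfun p q.1 q.2) := by
  have : Nonempty (Fin n) := ⟨0⟩
  unfold mfun
  simp_rw [← Finset.inf'_univ_eq_ciInf]
  apply Continuous.finset_inf'_apply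
  intro i _
  have : Continuous (fun q : (Fin n → ℝ) × ℝ => |q.2 - q.1 i|) := by fun_prop
  exact this.rpow_const (fun _ => Or.inr (by linarith))

lemma mfun_cont_right [NeZero n] {p : ℝ} (hp : 2 ≤ p) (K : Fin n → ℝ) :
    Continuous (mfun p K) := by
  have := (mfun_cont (n := n) hp).comp (Continuous.prodMk_right K)
  exact this

lemma mfun_cont_left [NeZero n] {p : ℝ} (hp : 2 ≤ p) (x : ℝ) :
    Continuous (fun K : Fin n → ℝ => mfun p K x) := by
  have := (mfun_cont (n := n) hp).comp (Continuous.prodMk_left x)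
  exact this

lemma mfun_nonneg [NeZero n] (p : ℝ) (K : Fin n → ℝ) (x : ℝ) : 0 ≤ mfun p K x := by
  obtain ⟨j, hj⟩ := mfun_exists p K x
  rw [← hj]; positivity

def IsMinz (p : ℝ) (μ : Measure ℝ) (K : Fin n → ℝ) : Prop :=
  ∀ K' : Fin n → ℝ, ∫ x, mfun p K x ∂μ ≤ ∫ x, mfun p K' x ∂μ

/-- redundancy is impossible -/
lemma QData.not_redundant [NeZero n] (h : QData f Kbar μ) {p : ℝ} (hp : 2 ≤ p) {K : Fin n → ℝ}
    (hK : IsMinz p μ K) (j : Fin n)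
    (hr : ∀ᵐ x ∂μ, ∃ i, i ≠ j ∧ |x - K i| ≤ |x - K j|) : False := by
  have hp0 : 0 < p := by linarith
  obtain ⟨u, v, huv, fu, fv⟩ := h.exists_two
  obtain ⟨k, hk, hkr⟩ := (Set.Ioo_infinite huv).exists_notMem_finite (Set.finite_range K)
  set K' := Function.update K j k with hK'
  have hle : ∀ᵐ x ∂μ, mfun p K' x ≤ mfun p K x := by
    filter_upwards [hr] with x hx
    obtain ⟨i, hij, hi⟩ := hx
    obtain ⟨l, hl⟩ := mfun_exists p K x
    rw [← hl]
    by_cases hlj : l = j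
    · subst hlj
      have h1 := mfun_le p K' x i
      rw [hK', Function.update_of_ne hij] at h1
      exact h1.trans (Real.rpow_le_rpow (abs_nonneg _) hi hp0.le)
    · have h1 := mfun_le p K' x l
      rwa [hK', Function.update_of_ne hlj] at h1
  have i1 := h.integrable_cont (mfun_cont_right hp K)
  have i2 := h.integrable_cont (mfun_cont_right hp K')
  have hz : (fun x => mfun p K x - mfun p K' x) =ᵐ[μ] 0 := by
    refine ae_zero (i1.sub i2) ?_ ?_
    · have e := integral_sub i1 i2
      apply le_antisymm
      · have := hK K'
        linarith
      · apply integral_nonneg_of_ae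
        filter_upwards [hle] with x hx
        simpa using hx
    · filter_upwards [hle] with x hx
      simpa using hx
  set O := {x | |x - k| ^ p < mfun p K x} ∩ Set.Ioo u v with hO
  have hOo : IsOpen O := by
    apply IsOpen.inter _ isOpen_Ioo
    apply isOpen_lt _ (mfun_cont_right hp K)
    have : Continuous (fun x : ℝ => |x - k|) := by fun_prop
    exact this.rpow_const (fun _ => Or.inr hp0.le)
  have hOn : O.Nonempty := by
    refine ⟨k, ?_, hk⟩
    obtain ⟨l, hl⟩ := mfun_exists p K k
    simp only [Set.mem_ofPred_eq, sub_self, abs_zero]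
    rw [← hl, Real.zero_rpow hp0.ne']
    apply Real.rpow_pos_of_pos
    rw [abs_pos, sub_ne_zero]
    rintro rfl
    exact hkr ⟨l, rfl⟩
  apply h.open_pos hOo hOn
  · intro x hx
    exact h.pos_between hx.2.1.le hx.2.2.le fu fv
  · have hz' : ∀ᵐ x ∂μ, x ∉ O := by
      filter_upwards [hz] with x hx hxO
      have h1 := mfun_le p K' x j
      rw [hK', Function.update_self] at h1
      have h2 : |x - k| ^ p < mfun p K x := hxO.1
      simp only [Pi.zero_apply] at hx
      linarith
    rw [ae_iff] at hz'
    simpa using hz'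

lemma QData.injective [NeZero n] (h : QData f Kbar μ) {p : ℝ} (hp : 2 ≤ p) {K : Fin n → ℝ}
    (hK : IsMinz p μ K) : Function.Injective K := by
  intro i j hij
  by_contra hne
  exact h.not_redundant hp hK j (Filter.Eventually.of_forall fun x => ⟨i, hne, by rw [hij]⟩)

/-- Voronoi cell -/
def cell (K : Fin n → ℝ) (j : Fin n) : Set ℝ := {x | ∀ i, |x - K j| ≤ |x - K i|}

lemma cell_meas (K : Fin n → ℝ) (j : Fin n) : MeasurableSet (cell K j) := by
  have : IsClosed (cell K j) := by
    unfold cell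
    simp only [Set.ofPred_forall]
    apply isClosed_iInter
    intro i
    apply isClosed_le <;> fun_prop
  exact this.measurableSet

noncomputable def psi (p u : ℝ) : ℝ := |u| ^ (p - 2) * u

lemma psi_pos {p u : ℝ} (hu : 0 < u) : 0 < psi p u :=
  mul_pos (Real.rpow_pos_of_pos (abs_pos.2 hu.ne') _) hu

lemma psi_neg {p u : ℝ} (hu : u < 0) : psi p u < 0 :=
  mul_neg_of_pos_of_neg (Real.rpow_pos_of_pos (abs_pos.2 hu.ne) _) hu

lemma psi_zero {p : ℝ} : psi p 0 = 0 := by simp [psi]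

lemma psi_cont {p : ℝ} (hp : 2 ≤ p) : Continuous (psi p) := by
  unfold psi
  exact (continuous_abs.rpow_const (fun _ => Or.inr (by linarith))).mul continuous_id

lemma psi_bound {p u R : ℝ} (hp : 2 ≤ p) (hu : |u| ≤ R) : |psi p u| ≤ R ^ (p - 2) * R := by
  unfold psi
  rw [abs_mul, abs_of_nonneg (by positivity : 0 ≤ |u| ^ (p - 2))]
  have hR : 0 ≤ R := (abs_nonneg u).trans hu
  exact mul_le_mul (Real.rpow_le_rpow (abs_nonneg _) hu (by linarith)) hu (abs_nonneg _)
    (by positivity)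

lemma cell_ineq [NeZero n] {p : ℝ} (hp : 2 ≤ p) (K : Fin n → ℝ) (j : Fin n) (k x : ℝ) :
    mfun p (Function.update K j k) x ≤
      mfun p K x + (cell K j).indicator (fun x => |x - k| ^ p - |x - K j| ^ p) x := by
  have hp0 : 0 < p := by linarith
  obtain ⟨l, hl⟩ := mfun_exists p K x
  by_cases hx : x ∈ cell K j
  · rw [Set.indicator_of_mem hx]
    have h1 := mfun_le p (Function.update K j k) x j
    rw [Function.update_self] at h1
    have h2 := Real.rpow_le_rpow (abs_nonneg _) (hx l) hp0.le
    linarith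
  · rw [Set.indicator_of_notMem hx, add_zero, ← hl]
    have hlj : l ≠ j := by
      rintro rfl
      apply hx
      intro i
      have h1 := mfun_le p K x i
      rw [← hl] at h1
      exact (Real.rpow_le_rpow_iff (abs_nonneg _) (abs_nonneg _) hp0).1 h1
    have h1 := mfun_le p (Function.update K j k) x l
    rwa [Function.update_of_ne hlj] at h1

lemma QData.stationary [NeZero n] (h : QData f Kbar μ) {p : ℝ} (hp : 2 ≤ p) {K : Fin n → ℝ}
    (hK : IsMinz p μ K) (j : Fin n) :
    ∫ x, (cell K j).indicator (fun x => psi p (x - K j)) x ∂μ = 0 := by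
  have := h.prob
  have hp0 : 0 < p := by linarith
  set C := cell K j with hC
  have hCm : MeasurableSet C := cell_meas K j
  set G : ℝ → ℝ → ℝ := fun k x => C.indicator (fun x => |x - k| ^ p - |x - K j| ^ p) x with hG
  have habs : ∀ k : ℝ, Continuous (fun x : ℝ => |x - k| ^ p) := by
    intro k
    have : Continuous (fun x : ℝ => |x - k|) := by fun_prop
    exact this.rpow_const (fun _ => Or.inr hp0.le)
  have hGi : ∀ k, Integrable (G k) μ := fun k =>
    (h.integrable_cont ((habs k).sub (habs (K j)))).indicator hCm
  have hmin : ∀ k, 0 ≤ ∫ x, G k x ∂μ := by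
    intro k
    have i1 := h.integrable_cont (mfun_cont_right hp K)
    have i2 := h.integrable_cont (mfun_cont_right hp (Function.update K j k))
    have h1 := hK (Function.update K j k)
    have h2 := integral_mono i2 (i1.add (hGi k)) (fun x => cell_ineq hp K j k x)
    have h3 := integral_add i1 (hGi k)
    simp only [Pi.add_apply] at h2
    linarith
  have h0 : ∫ x, G (K j) x ∂μ = 0 := by simp [hG]
  have hloc : IsLocalMin (fun k => ∫ x, G k x ∂μ) (K j) := by
    apply Filter.Eventually.of_forall
    intro k
    simp only [h0]
    exact hmin k
  set R := Kbar + |K j| + 1 with hR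
  have hder := hasDerivAt_integral_of_dominated_loc_of_deriv_le (μ := μ) (F := G)
    (F' := fun k x => C.indicator (fun x => -(p * psi p (x - k))) x) (x₀ := K j)
    (s := Metric.ball (K j) 1) (bound := fun _ => p * (R ^ (p - 2) * R))
    (Metric.ball_mem_nhds _ one_pos)
    (Filter.Eventually.of_forall fun k => (hGi k).aestronglyMeasurable)
    (hGi (K j))
    (by
      have : Continuous (fun x => -(p * psi p (x - K j))) := by
        have := psi_cont hp
        fun_prop
      exact (this.measurable.indicator hCm).aestronglyMeasurable)
    (by
      filter_upwards [h.ae_mem] with x hx k hk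
      refine (norm_indicator_le_norm_self _ _).trans ?_
      rw [norm_neg, norm_mul, Real.norm_of_nonneg hp0.le]
      apply mul_le_mul_of_nonneg_left _ hp0.le
      apply psi_bound hp
      rw [Metric.mem_ball, Real.dist_eq, abs_lt] at hk
      have := neg_abs_le (K j)
      have := le_abs_self (K j)
      rw [abs_le]
      constructor <;> linarith [hx.1, hx.2, hk.1, hk.2])
    (integrable_const _)
    (by
      refine Filter.Eventually.of_forall fun x k _ => ?_
      by_cases hx : x ∈ C
      · simp only [hG, Set.indicator_of_mem hx]
        have h1 := hasDerivAt_abs_rpow (x - k) (p := p) (by linarith)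
        have h2 : HasDerivAt (fun k : ℝ => x - k) (-1) k := by
          simpa using (hasDerivAt_id k).const_sub x
        have h3 := (h1.comp k h2).sub_const (|x - K j| ^ p)
        have h4 : p * |x - k| ^ (p - 2) * (x - k) * -1 = -(p * psi p (x - k)) := by
          simp only [psi]; ring
        rw [h4] at h3
        exact h3
      · simp only [hG, Set.indicator_of_notMem hx]
        exact hasDerivAt_const _ _)
  have hz := hloc.hasDerivAt_eq_zero hder.2
  have e : ∀ x, C.indicator (fun x => -(p * psi p (x - K j))) x
      = (-p) * C.indicator (fun x => psi p (x - K j)) x := by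
    intro x
    by_cases hx : x ∈ C
    · simp only [Set.indicator_of_mem hx]; ring
    · simp only [Set.indicator_of_notMem hx]; ring
  replace hz := (integral_congr_ae (μ := μ) (Filter.Eventually.of_forall e)).symm.trans hz
  rw [integral_const_mul] at hz
  rcases mul_eq_zero.1 hz with h1 | h1
  · linarith
  · exact h1

lemma QData.ind_integrable (h : QData f Kbar μ) {p : ℝ} (hp : 2 ≤ p) (K : Fin n → ℝ)
    (j : Fin n) : Integrable (fun x => (cell K j).indicator (fun x => psi p (x - K j)) x) μ :=
  (h.integrable_cont ((psi_cont hp).comp (continuous_sub_right (K j)))).indicator (cell_meas K j)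

lemma QData.cell_contra [NeZero n] (h : QData f Kbar μ) {p : ℝ} (hp : 2 ≤ p) {K : Fin n → ℝ}
    (hK : IsMinz p μ K) (j : Fin n)
    (hz : (fun x => (cell K j).indicator (fun x => psi p (x - K j)) x) =ᵐ[μ] 0) : False := by
  apply h.not_redundant hp hK j
  filter_upwards [hz, h.ae_ne (K j)] with x hx hne
  have hxc : x ∉ cell K j := by
    intro hc
    rw [Set.indicator_of_mem hc] at hx
    simp only [Pi.zero_apply] at hx
    rcases lt_or_gt_of_ne hne with h1 | h1
    · exact (psi_neg (p := p) (sub_neg.2 h1)).ne hx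
    · exact (psi_pos (p := p) (sub_pos.2 h1)).ne' hx
  simp only [cell, Set.mem_ofPred_eq, not_forall, not_le] at hxc
  obtain ⟨i, hi⟩ := hxc
  exact ⟨i, by rintro rfl; exact lt_irrefl _ hi, hi.le⟩

lemma QData.exists_left [NeZero n] (h : QData f Kbar μ) {p : ℝ} (hp : 2 ≤ p) {K : Fin n → ℝ}
    (hK : IsMinz p μ K) (j : Fin n) : ∃ u < K j, 0 < f u := by
  by_contra! hc
  apply h.cell_contra hp hK j
  refine ae_zero (h.ind_integrable hp K j) ?_ ?_
  · exact h.stationary hp hK j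
  · filter_upwards [h.ae_pos] with x hx
    have hxk : K j ≤ x := by
      by_contra! hlt
      linarith [hc x hlt]
    by_cases hx' : x ∈ cell K j
    · rw [Set.indicator_of_mem hx']
      rcases eq_or_lt_of_le hxk with e | e
      · simp [← e, psi_zero]
      · exact (psi_pos (sub_pos.2 e)).le
    · rw [Set.indicator_of_notMem hx']; simp

lemma QData.exists_right [NeZero n] (h : QData f Kbar μ) {p : ℝ} (hp : 2 ≤ p) {K : Fin n → ℝ}
    (hK : IsMinz p μ K) (j : Fin n) : ∃ v, K j < v ∧ 0 < f v := by
  by_contra! hc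
  apply h.cell_contra hp hK j
  have key : (fun x => -(cell K j).indicator (fun x => psi p (x - K j)) x) =ᵐ[μ] 0 := by
    refine ae_zero (h.ind_integrable hp K j).neg ?_ ?_
    · rw [integral_neg, h.stationary hp hK j, neg_zero]
    · filter_upwards [h.ae_pos] with x hx
      have hxk : x ≤ K j := by
        by_contra! hlt
        linarith [hc x hlt]
      by_cases hx' : x ∈ cell K j
      · rw [Set.indicator_of_mem hx']
        rcases eq_or_lt_of_le hxk with e | e
        · simp [e, psi_zero]
        · have := (psi_neg (p := p) (sub_neg.2 e)).le
          simpa using this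
      · rw [Set.indicator_of_notMem hx']; simp
  filter_upwards [key] with x hx
  simpa using hx

lemma QData.fK_pos [NeZero n] (h : QData f Kbar μ) {p : ℝ} (hp : 2 ≤ p) {K : Fin n → ℝ}
    (hK : IsMinz p μ K) (j : Fin n) : 0 < f (K j) := by
  obtain ⟨u, hu, fu⟩ := h.exists_left hp hK j
  obtain ⟨v, hv, fv⟩ := h.exists_right hp hK j
  exact h.pos_between hu.le hv.le fu fv

/-- Lebesgue form of stationarity -/
lemma QData.stat_leb [NeZero n] (h : QData f Kbar μ) {p : ℝ} (hp : 2 ≤ p) {K : Fin n → ℝ}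
    (hK : IsMinz p μ K) (j : Fin n) :
    Integrable (fun x => f x * (cell K j).indicator (fun x => psi p (x - K j)) x) ∧
    ∫ x, f x * (cell K j).indicator (fun x => psi p (x - K j)) x = 0 := by
  have h1 := h.stationary hp hK j
  have h2 := h.ind_integrable hp K j
  rw [h.dens] at h1 h2
  rw [integral_withDensity_eq_integral_toReal_smul h.meas'
    (Filter.Eventually.of_forall fun _ => ENNReal.ofReal_lt_top)] at h1
  rw [integrable_withDensity_iff_integrable_smul' h.meas'
    (Filter.Eventually.of_forall fun _ => ENNReal.ofReal_lt_top)] at h2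
  simp only [ENNReal.toReal_ofReal (h.nn _), smul_eq_mul] at h1 h2
  exact ⟨h2, h1⟩

/-- pointwise comparison -/
lemma QData.compare (h : QData f Kbar μ) {p : ℝ} {K L : Fin n → ℝ}
    (hKm : StrictMono K) (hLm : StrictMono L) {D : ℝ} (hD : 0 < D) {j : Fin n}
    (hj : L j = K j + D) (hmax : ∀ i, L i ≤ K i + D) (y : ℝ) :
    f (K j) * (f (y + D) * (cell L j).indicator (fun x => psi p (x - L j)) (y + D)) ≤
      f (L j) * (f y * (cell K j).indicator (fun x => psi p (x - K j)) y) := by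
  have e : y + D - L j = y - K j := by rw [hj]; ring
  rcases lt_trichotomy y (K j) with hy | hy | hy
  · have hps : psi p (y - K j) < 0 := psi_neg (sub_neg.2 hy)
    by_cases hc : y ∈ cell K j
    · have hc' : y + D ∈ cell L j := by
        intro i
        have h1 := hc i
        rw [e, abs_of_neg (sub_neg.2 hy)]
        rw [abs_of_neg (sub_neg.2 hy)] at h1
        rcases lt_trichotomy i j with hi | hi | hi
        · have h3 := hKm hi
          have h4 := hmax i
          rcases abs_cases (y - K i) with ⟨h5, h6⟩ | ⟨h5, h6⟩ <;> rw [h5] at h1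
          · have := le_abs_self (y + D - L i); linarith
          · linarith
        · rw [hi, e, abs_of_neg (sub_neg.2 hy)]
        · have h3 := hLm hi
          have := neg_le_abs (y + D - L i); linarith
      rw [Set.indicator_of_mem hc, Set.indicator_of_mem hc', e, hj]
      have := h.mlr hy.le hD
      nlinarith
    · rw [Set.indicator_of_notMem hc, mul_zero, mul_zero]
      by_cases hc' : y + D ∈ cell L j
      · rw [Set.indicator_of_mem hc', e]
        have := mul_nonneg (h.nn (K j)) (h.nn (y + D))
        nlinarith
      · rw [Set.indicator_of_notMem hc']; simp
  · have e' : y + D = L j := by rw [hj, hy]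
    rw [e', hy]
    have a1 : (cell L j).indicator (fun x => psi p (x - L j)) (L j) = 0 := by
      apply Set.indicator_apply_eq_zero.2; intro _; simp [psi_zero]
    have a2 : (cell K j).indicator (fun x => psi p (x - K j)) (K j) = 0 := by
      apply Set.indicator_apply_eq_zero.2; intro _; simp [psi_zero]
    rw [a1, a2]; simp
  · have hps : 0 < psi p (y - K j) := psi_pos (sub_pos.2 hy)
    by_cases hc' : y + D ∈ cell L j
    · have hc : y ∈ cell K j := by
        intro i
        have h1 := hc' i
        rw [e] at h1
        rw [abs_of_pos (sub_pos.2 hy)] at h1 ⊢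
        rcases lt_trichotomy i j with hi | hi | hi
        · have h3 := hKm hi
          have := le_abs_self (y - K i); linarith
        · rw [hi, abs_of_pos (sub_pos.2 hy)]
        · have h3 := hLm hi
          have h4 := hmax i
          rcases abs_cases (y + D - L i) with ⟨h5, h6⟩ | ⟨h5, h6⟩ <;> rw [h5] at h1
          · linarith
          · have := neg_le_abs (y - K i); linarith
      rw [Set.indicator_of_mem hc, Set.indicator_of_mem hc', e, hj]
      have := h.mlr hy.le hD
      nlinarith
    · rw [Set.indicator_of_notMem hc', mul_zero, mul_zero]
      by_cases hc : y ∈ cell K j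
      · rw [Set.indicator_of_mem hc]
        exact mul_nonneg (h.nn _) (mul_nonneg (h.nn _) hps.le)
      · rw [Set.indicator_of_notMem hc]; simp

lemma QData.le_of_min [NeZero n] (h : QData f Kbar μ) {p : ℝ} (hp : 2 ≤ p) {K L : Fin n → ℝ}
    (hK : IsMinz p μ K) (hL : IsMinz p μ L) (hKm : StrictMono K) (hLm : StrictMono L) :
    ∀ i, L i ≤ K i := by
  by_contra! hex
  obtain ⟨i0, hi0⟩ := hex
  have : Nonempty (Fin n) := ⟨0⟩
  obtain ⟨j1, hj1⟩ := Finite.exists_max (fun i => L i - K i)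
  set D := L j1 - K j1 with hDdef
  have hD : 0 < D := by have := hj1 i0; linarith
  have hmax : ∀ i, L i ≤ K i + D := fun i => by have := hj1 i; linarith
  -- smallest index attaining the maximum
  obtain ⟨j, hj, hjmin⟩ : ∃ j, L j = K j + D ∧ ∀ i < j, L i < K i + D := by
    have hne : (Finset.univ.filter (fun i => L i = K i + D)).Nonempty :=
      ⟨j1, by simp [hDdef]⟩
    refine ⟨Finset.min' _ hne, (Finset.mem_filter.1 (Finset.min'_mem _ hne)).2, ?_⟩
    intro i hi
    refine lt_of_le_of_ne (hmax i) fun he => ?_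
    exact absurd (Finset.min'_le _ i (by simp [he])) (not_le.2 hi)
  obtain ⟨iK, eK⟩ := h.stat_leb hp hK j
  obtain ⟨iL, eL⟩ := h.stat_leb hp hL j
  have iL' := (iL.comp_add_right D).const_mul (f (K j))
  have iK' := iK.const_mul (f (L j))
  have eL' := integral_add_right_eq_self (μ := volume)
    (fun x => f x * (cell L j).indicator (fun x => psi p (x - L j)) x) D
  have hcmp := h.compare (p := p) hKm hLm hD hj hmax
  have hz : (fun y => f (L j) * (f y * (cell K j).indicator (fun x => psi p (x - K j)) y) -
      f (K j) * (f (y + D) * (cell L j).indicator (fun x => psi p (x - L j)) (y + D)))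
      =ᵐ[volume] 0 := by
    refine ae_zero (iK'.sub iL') ?_ ?_
    · rw [integral_sub iK' iL', integral_const_mul, integral_const_mul, eK, eL', eL]; simp
    · exact Filter.Eventually.of_forall fun y => sub_nonneg.2 (hcmp y)
  -- strictness on an interval
  have hbad : ∀ a b : ℝ, a < b → (∀ y ∈ Set.Ioo a b, y < K j ∧ 0 < f (y + D) ∧
      y + D ∈ cell L j ∧ (y ∉ cell K j ∨ f y = 0)) → False := by
    intro a b hab hall
    have hz' : ∀ᵐ y ∂(volume : Measure ℝ), y ∉ Set.Ioo a b := by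
      filter_upwards [hz] with y hy hyI
      obtain ⟨h1, h2, h3, h4⟩ := hall y hyI
      have e : y + D - L j = y - K j := by rw [hj]; ring
      have hps : psi p (y - K j) < 0 := psi_neg (sub_neg.2 h1)
      have hzero : f y * (cell K j).indicator (fun x => psi p (x - K j)) y = 0 := by
        rcases h4 with h4 | h4
        · rw [Set.indicator_of_notMem h4, mul_zero]
        · rw [h4, zero_mul]
      simp only [hzero, Set.indicator_of_mem h3, e, Pi.zero_apply] at hy
      have := mul_neg_of_pos_of_neg (h.fK_pos hp hK j) (mul_neg_of_pos_of_neg h2 hps)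
      linarith
    rw [ae_iff] at hz'
    simp only [not_not, Set.ofPred_mem_eq] at hz'
    rw [Real.volume_Ioo] at hz'
    simp at hz'
    linarith
  by_cases hj0 : (j : ℕ) = 0
  · -- the first cell
    have hnolt : ∀ i : Fin n, j ≤ i := fun i => by rw [Fin.le_def]; omega
    have hbdd : BddBelow {x | 0 < f x} := by
      refine ⟨0, fun x hx => ?_⟩
      by_contra! hlt
      have hx' : 0 < f x := hx
      rw [h.supp x (fun hm => by linarith [hm.1])] at hx'
      exact lt_irrefl _ hx'
    have hne : {x | 0 < f x}.Nonempty := ⟨_, h.fK_pos hp hK j⟩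
    set s := sInf {x | 0 < f x} with hs
    have hsK : s ≤ K j := csInf_le hbdd (h.fK_pos hp hK j)
    apply hbad (s - D) s (by linarith)
    rintro y ⟨hy1, hy2⟩
    refine ⟨by linarith, ?_, ?_, Or.inr ?_⟩
    · obtain ⟨w, hw, hws⟩ := exists_lt_of_csInf_lt hne (show s < y + D by linarith)
      exact h.pos_between hws.le (by linarith) hw (h.fK_pos hp hL j)
    · intro i
      have h1 := hLm.monotone (hnolt i)
      rw [abs_of_nonpos (by linarith), abs_of_nonpos (by linarith)]
      linarith
    · by_contra hne0
      have : s ≤ y := csInf_le hbdd (lt_of_le_of_ne (h.nn y) (Ne.symm hne0))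
      linarith
  · have hjn := j.2
    set i : Fin n := ⟨j - 1, by omega⟩ with hi
    have hij : i < j := by rw [Fin.lt_def, hi]; simp only; omega
    have hil : ∀ l < j, l ≤ i := fun l hl => by
      rw [Fin.lt_def] at hl; rw [Fin.le_def, hi]; simp only; omega
    have hd := hjmin i hij
    have hKij := hKm hij
    have hLij := hLm hij
    apply hbad ((L i + L j) / 2 - D) ((K i + K j) / 2) (by linarith)
    rintro y ⟨hy1, hy2⟩
    refine ⟨by linarith, ?_, ?_, Or.inl ?_⟩
    · exact h.pos_between (x := L i) (y := L j) (by linarith) (by linarith)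
        (h.fK_pos hp hL i) (h.fK_pos hp hL j)
    · intro l
      rw [abs_of_nonpos (by linarith)]
      rcases lt_or_ge l j with hl | hl
      · have := hLm.monotone (hil l hl)
        have := le_abs_self (y + D - L l)
        linarith
      · have := hLm.monotone hl
        have := neg_le_abs (y + D - L l)
        linarith
    · intro hc
      have h1 := hc i
      rw [abs_of_nonpos (by linarith : y - K j ≤ 0)] at h1
      rcases abs_cases (y - K i) with ⟨h5, h6⟩ | ⟨h5, h6⟩ <;> rw [h5] at h1 <;> linarith

lemma QData.exists_min [NeZero n] (h : QData f Kbar μ) {p : ℝ} (hp : 2 ≤ p) :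
    ∃ K : Fin n → ℝ, IsMinz p μ K := by
  have := h.prob
  have hp0 : 0 < p := by linarith
  have hk := h.kpos
  set B : Set (Fin n → ℝ) := Set.Icc (fun _ => 0) (fun _ => Kbar) with hB
  have hBc : IsCompact B := isCompact_Icc
  have hBn : B.Nonempty := ⟨fun _ => 0, by
    refine ⟨le_refl _, fun _ => h.kpos.le⟩⟩
  have hcont : ContinuousOn (fun K : Fin n → ℝ => ∫ x, mfun p K x ∂μ) B := by
    apply continuousOn_of_dominated (bound := fun _ => Kbar ^ p)
    · intro K _
      exact (mfun_cont_right hp K).measurable.aestronglyMeasurable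
    · intro K hK
      filter_upwards [h.ae_mem] with x hx
      rw [Real.norm_of_nonneg (mfun_nonneg p K x)]
      refine (mfun_le p K x 0).trans (Real.rpow_le_rpow (abs_nonneg _) ?_ hp0.le)
      have h1 := hK.1 0
      have h2 := hK.2 0
      simp only at h1 h2
      rw [abs_le]; constructor <;> linarith [hx.1, hx.2]
    · exact integrable_const _
    · exact Filter.Eventually.of_forall fun x => (mfun_cont_left hp x).continuousOn
  obtain ⟨K, hKB, hK⟩ := hBc.exists_isMinOn hBn hcont
  refine ⟨K, fun K' => ?_⟩
  have hcl : (fun j => max 0 (min Kbar (K' j))) ∈ B :=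
    ⟨fun j => le_max_left _ _, fun j => max_le hk.le (min_le_left _ _)⟩
  refine (hK hcl).trans ?_
  apply integral_mono_ae (h.integrable_cont (mfun_cont_right hp _))
    (h.integrable_cont (mfun_cont_right hp _))
  filter_upwards [h.ae_mem] with x hx
  obtain ⟨l, hl⟩ := mfun_exists p K' x
  rw [← hl]
  refine (mfun_le p _ x l).trans (Real.rpow_le_rpow (abs_nonneg _) ?_ hp0.le)
  obtain ⟨h1, h2⟩ := hx
  have a1 := le_abs_self (x - K' l)
  have a2 := neg_le_abs (x - K' l)
  rcases max_cases 0 (min Kbar (K' l)) with ⟨e, b⟩ | ⟨e, b⟩ <;> rw [e] <;>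
  rcases min_cases Kbar (K' l) with ⟨e', b'⟩ | ⟨e', b'⟩ <;> rw [abs_le] <;>
  constructor <;> linarith

lemma int_sort (p : ℝ) (K : Fin n → ℝ) (σ : Equiv.Perm (Fin n)) :
    ∫ x, mfun p (K ∘ σ) x ∂μ = ∫ x, mfun p K x ∂μ := by
  congr 1
  ext x
  exact Equiv.iInf_comp (g := fun j => |x - K j| ^ p) σ

end Quant

/-- **Existence, uniqueness and non-degeneracy of the optimal quantizer for a
log-concave compactly supported density.**
Let `p ≥ 2`, `n ≥ 1`, and let `μ` be a probability measure on `ℝ` with density `f`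
(with respect to Lebesgue measure) which is log-concave and supported in `[0, K̄]`,
`K̄ > 0`. Then the quantization problem
`min_{K_1 ≤ ... ≤ K_n} ∫ min_j |x − K_j|^p μ(dx)` has a unique solution, and this
solution is non-degenerate: `K_1 < K_2 < ... < K_n`. -/
theorem quantization_unique_nondegenerate_solution
    (p : ℝ) (hp : 2 ≤ p) (n : ℕ) (hn : 1 ≤ n)
    (f : ℝ → ℝ) (hf_nonneg : ∀ x, 0 ≤ f x)
    (hf_logconcave : ∀ x y t : ℝ, 0 ≤ t → t ≤ 1 →
      f x ^ t * f y ^ (1 - t) ≤ f (t * x + (1 - t) * y))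
    (Kbar : ℝ) (hKbar : 0 < Kbar)
    (hf_supp : ∀ x : ℝ, x ∉ Set.Icc (0 : ℝ) Kbar → f x = 0)
    (μ : Measure ℝ) [IsProbabilityMeasure μ]
    (hμ : μ = volume.withDensity fun x => ENNReal.ofReal (f x))
    (F : (Fin n → ℝ) → ℝ)
    (hF : ∀ K : Fin n → ℝ, F K = ∫ x, (⨅ j : Fin n, |x - K j| ^ p) ∂μ) :
    (∃! K : Fin n → ℝ, Monotone K ∧ ∀ K' : Fin n → ℝ, Monotone K' → F K ≤ F K')
      ∧ ∀ K : Fin n → ℝ, Monotone K → (∀ K' : Fin n → ℝ, Monotone K' → F K ≤ F K')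
          → StrictMono K := by
  have : NeZero n := ⟨by omega⟩
  have h : Quant.QData f Kbar μ :=
    ⟨hf_nonneg, hf_logconcave, hKbar, hf_supp, hμ, inferInstance⟩
  have hF' : ∀ K, F K = ∫ x, Quant.mfun p K x ∂μ := hF
  have hall : ∀ K : Fin n → ℝ, (∀ K' : Fin n → ℝ, Monotone K' → F K ≤ F K') →
      Quant.IsMinz p μ K := by
    intro K hK K'
    have h1 := hK _ (Tuple.monotone_sort K')
    rwa [hF', hF', Quant.int_sort] at h1
  have hstrict : ∀ K : Fin n → ℝ, Monotone K → (∀ K' : Fin n → ℝ, Monotone K' → F K ≤ F K') →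
      StrictMono K := fun K hm hK =>
    hm.strictMono_of_injective (h.injective hp (hall K hK))
  refine ⟨?_, hstrict⟩
  obtain ⟨K, hK⟩ := h.exists_min (n := n) hp
  have hS : ∀ K' : Fin n → ℝ, Monotone K' → F (K ∘ Tuple.sort K) ≤ F K' := by
    intro K' _
    rw [hF', hF', Quant.int_sort]
    exact hK K'
  refine ⟨K ∘ Tuple.sort K, ⟨Tuple.monotone_sort K, hS⟩, ?_⟩
  rintro L ⟨hLm, hL⟩
  have s1 := hstrict _ (Tuple.monotone_sort K) hS
  have s2 := hstrict _ hLm hL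
  funext i
  exact le_antisymm (h.le_of_min hp (hall _ hS) (hall _ hL) s1 s2 i)
    (h.le_of_min hp (hall _ hL) (hall _ hS) s2 s1 i)
end

section
/- Let p ≥ 2 be a real number, n ≥ 2 an integer, and let μ be a probability measure on ℝ admitting a log-concave density supported in a compact interval [0, K̄], K̄ > 0. Then an increasing tuple K_1 < ... < K_n is the solution of the quantization problem min ∫_ℝ min_{1≤j≤n} |x − K_j|^p μ(dx) if and only if for every i ∈ {1,...,n} the Voronoi cell A_i satisfies ∫_{A_i} |x − K_i|^{p−2} μ(dx) > 0 and K_i = ( ∫_{A_i} x |x − K_i|^{p−2} μ(dx) ) / ( ∫_{A_i} |x − K_i|^{p−2} μ(dx) ); that is, the optimal strikes are exactly the fixed points of the Lloyd's algorithm. -/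
open MeasureTheory

/-- Log-concavity in multiplicative form. -/
def QLC (f : ℝ → ℝ) : Prop := ∀ x y t : ℝ, 0 ≤ t → t ≤ 1 →
      f x ^ t * f y ^ (1 - t) ≤ f (t * x + (1 - t) * y)

lemma qlc_pos {f : ℝ → ℝ} (hlc : QLC f) {a y b : ℝ} (hay : a ≤ y) (hyb : y ≤ b)
    (ha : 0 < f a) (hb : 0 < f b) : 0 < f y := by
  rcases eq_or_lt_of_le (hay.trans hyb) with h | h
  · have : y = a := by linarith
    rwa [this]
  · have hd : 0 < b - a := by linarith
    have := hlc a b ((b - y) / (b - a)) (div_nonneg (by linarith) hd.le)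
      ((div_le_one hd).2 (by linarith))
    have e : (b - y) / (b - a) * a + (1 - (b - y) / (b - a)) * b = y := by
      field_simp; ring
    rw [e] at this
    exact lt_of_lt_of_le (by positivity) this

lemma qlc_level {f : ℝ → ℝ} (hlc : QLC f) {a y b s : ℝ} (hs : 0 < s) (hay : a ≤ y) (hyb : y ≤ b)
    (ha : s ≤ f a) (hb : s ≤ f b) : s ≤ f y := by
  rcases eq_or_lt_of_le (hay.trans hyb) with h | h
  · have : y = a := by linarith
    rwa [this]
  · have hd : 0 < b - a := by linarith
    have h0 : 0 ≤ (b - y) / (b - a) := div_nonneg (by linarith) hd.le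
    have h1 : (b - y) / (b - a) ≤ 1 := (div_le_one hd).2 (by linarith)
    have := hlc a b ((b - y) / (b - a)) h0 h1
    have e : (b - y) / (b - a) * a + (1 - (b - y) / (b - a)) * b = y := by
      field_simp; ring
    rw [e] at this
    refine le_trans ?_ this
    calc s = s ^ ((b - y) / (b - a)) * s ^ (1 - (b - y) / (b - a)) := by
          rw [← Real.rpow_add hs]; simp
      _ ≤ _ := by
          apply mul_le_mul
          · exact Real.rpow_le_rpow hs.le ha h0
          · exact Real.rpow_le_rpow hs.le hb (by linarith)
          · positivity
          · exact Real.rpow_nonneg (hs.le.trans ha) _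

lemma qlc_measurable {f : ℝ → ℝ} (hlc : QLC f) (hf : ∀ x, 0 ≤ f x) : Measurable f := by
  apply measurable_of_Ici
  intro s
  rcases le_or_gt s 0 with h | h
  · have : f ⁻¹' Set.Ici s = Set.univ := by
      ext x; simp [h.trans (hf x)]
    rw [this]; exact MeasurableSet.univ
  · apply Set.OrdConnected.measurableSet
    refine ⟨fun a ha b hb y hy => ?_⟩
    exact qlc_level hlc h hy.1 hy.2 ha hb

lemma qlc_ratio {f : ℝ → ℝ} (hlc : QLC f) (hf : ∀ x, 0 ≤ f x) (l d t : ℝ)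
    (hd : 0 < d) (ht : 0 ≤ t) : f (l + d + t) * f l ≤ f (l + t) * f (l + d) := by
  have hs : 0 < d + t := by linarith
  rcases eq_or_lt_of_le (hf l) with h | h
  · rw [← h]; simp; exact mul_nonneg (hf _) (hf _)
  rcases eq_or_lt_of_le (hf (l + d + t)) with h' | h'
  · rw [← h']; simp; exact mul_nonneg (hf _) (hf _)
  have h0 : 0 ≤ d / (d + t) := by positivity
  have h1 : d / (d + t) ≤ 1 := (div_le_one hs).2 (by linarith)
  have A := hlc l (l + d + t) (d / (d + t)) h0 h1
  have B := hlc (l + d + t) l (d / (d + t)) h0 h1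
  have e1 : d / (d + t) * l + (1 - d / (d + t)) * (l + d + t) = l + t := by
    field_simp; ring
  have e2 : d / (d + t) * (l + d + t) + (1 - d / (d + t)) * l = l + d := by
    field_simp; ring
  rw [e1] at A
  rw [e2] at B
  have := mul_le_mul A B (by positivity) (hf _)
  refine le_trans (le_of_eq ?_) this
  set r := d / (d + t)
  calc f (l + d + t) * f l = (f (l+d+t) ^ (r + (1 - r))) * (f l ^ (r + (1 - r))) := by simp
    _ = _ := by rw [Real.rpow_add h, Real.rpow_add h']; ring

/-- The centred Voronoi cell. -/
def qcell {n : ℕ} (K : Fin n → ℝ) (i : Fin n) : Set ℝ := {t | ∀ j, |t| ≤ |t - (K j - K i)|}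

lemma qcell_meas {n : ℕ} (K : Fin n → ℝ) (i : Fin n) : MeasurableSet (qcell K i) := by
  have : qcell K i = ⋂ j, {t | |t| ≤ |t - (K j - K i)|} := by
    ext; simp [qcell]
  rw [this]
  exact (isClosed_iInter fun j => isClosed_le (by fun_prop) (by fun_prop)).measurableSet

lemma ae_ne_interval {u v : ℝ → ℝ} (h : u =ᵐ[volume] v) {a b : ℝ} (hab : a < b)
    (hne : ∀ t, a < t → t < b → u t ≠ v t) : False := by
  have h0 : volume {t | ¬ u t = v t} = 0 := h
  have h1 : volume (Set.Ioo a b) ≤ volume {t | ¬ u t = v t} :=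
    measure_mono fun t ht => hne t ht.1 ht.2
  rw [h0, Real.volume_Ioo] at h1
  simp at h1
  linarith

lemma abs_le_sub_of_pos {t c : ℝ} (hc : 0 < c) : |t| ≤ |t - c| ↔ 2 * t ≤ c := by
  rw [← sq_le_sq]; constructor <;> intro h <;> nlinarith

lemma abs_le_sub_of_neg {t c : ℝ} (hc : c < 0) : |t| ≤ |t - c| ↔ c ≤ 2 * t := by
  rw [← sq_le_sq]; constructor <;> intro h <;> nlinarith

lemma qcompare {f : ℝ → ℝ} (hlc : QLC f) (hf : ∀ x, 0 ≤ f x) {Kbar : ℝ}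
    (hsupp : ∀ x : ℝ, x ∉ Set.Icc (0 : ℝ) Kbar → f x = 0)
    {n : ℕ} {K L : Fin n → ℝ} (hK : StrictMono K) (hL : StrictMono L) {q : ℝ}
    (hI : ∀ (c : ℝ) (S : Set ℝ), MeasurableSet S → 
      Integrable (S.indicator fun t => t * |t| ^ q * f (c + t)) volume)
    (hKp : ∀ i, 0 < f (K i)) (hLp : ∀ i, 0 < f (L i))
    (hK0 : ∀ i, ∫ t, (qcell K i).indicator (fun t => t * |t| ^ q * f (K i + t)) t = 0)
    (hL0 : ∀ i, ∫ t, (qcell L i).indicator (fun t => t * |t| ^ q * f (L i + t)) t = 0)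
    (i : Fin n) : K i ≤ L i := by
  classical
  by_contra hcon
  push Not at hcon
  have : Nonempty (Fin n) := ⟨i⟩
  obtain ⟨m, hm⟩ := Finite.exists_max fun j => K j - L j
  -- minimal maximiser
  have hex : ∃ m : Fin n, (∀ j, K j - L j ≤ K m - L m) ∧ ∀ j, j < m → K j - L j < K m - L m := by
    let S := Finset.univ.filter fun m : Fin n => ∀ j, K j - L j ≤ K m - L m
    have hS : S.Nonempty := ⟨m, by simp only [S, Finset.mem_filter, Finset.mem_univ, true_and]; exact hm⟩
    have hmem := S.min'_mem hS
    have hm2 : ∀ j, K j - L j ≤ K (S.min' hS) - L (S.min' hS) := by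
      have := (Finset.mem_filter.1 hmem).2
      exact this
    refine ⟨S.min' hS, hm2, fun j hj => ?_⟩
    by_contra hc
    push Not at hc
    have : j ∈ S := by
      simp only [S, Finset.mem_filter, Finset.mem_univ, true_and]
      exact fun k => (hm2 k).trans hc
    exact absurd (S.min'_le j this) (not_le.2 hj)
  clear hm m
  obtain ⟨m, hm, hmin⟩ := hex
  have hd : 0 < K m - L m := lt_of_lt_of_le (by linarith) (hm i)
  set d := K m - L m with hd_def
  have hKm : K m = L m + d := by rw [hd_def]; ring
  set u1 := (qcell K m).indicator (fun t => t * |t| ^ q * f (K m + t)) with hu1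
  set u2 := (qcell L m).indicator (fun t => t * |t| ^ q * f (K m + t)) with hu2
  set u3 := (qcell L m).indicator (fun t => t * |t| ^ q * f (L m + t)) with hu3
  have i1 : Integrable u1 volume := hI _ _ (qcell_meas _ _)
  have i2 : Integrable u2 volume := hI _ _ (qcell_meas _ _)
  have i3 : Integrable u3 volume := hI _ _ (qcell_meas _ _)
  have z1 : ∫ t, u1 t = 0 := hK0 m
  have z3 : ∫ t, u3 t = 0 := hL0 m
  have hpos : ∀ t : ℝ, 0 ≤ t → t ∈ qcell K m → t ∈ qcell L m := by
    intro t ht h j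
    rcases lt_trichotomy j m with hj | hj | hj
    · rw [abs_le_sub_of_neg (by linarith [hL hj])]; linarith [hL hj]
    · subst hj; simp
    · rw [abs_le_sub_of_pos (by linarith [hL hj])]
      have := (abs_le_sub_of_pos (by linarith [hK hj])).1 (h j)
      linarith [hm j]
  have hneg : ∀ t : ℝ, t ≤ 0 → t ∈ qcell L m → t ∈ qcell K m := by
    intro t ht h j
    rcases lt_trichotomy j m with hj | hj | hj
    · rw [abs_le_sub_of_neg (by linarith [hK hj])]
      have := (abs_le_sub_of_neg (by linarith [hL hj])).1 (h j)
      linarith [hm j]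
    · subst hj; simp
    · rw [abs_le_sub_of_pos (by linarith [hK hj])]; linarith [hK hj]
  have hnn : ∀ (c t : ℝ), 0 ≤ |t| ^ q * f (c + t) := fun c t =>
    mul_nonneg (Real.rpow_nonneg (abs_nonneg _) _) (hf _)
  have le12 : ∀ t, u1 t ≤ u2 t := by
    intro t
    have h3 := hnn (K m) t
    simp only [hu1, hu2, Set.indicator_apply]
    rcases le_total 0 t with ht | ht
    · have hv : 0 ≤ t * |t| ^ q * f (K m + t) := by rw [mul_assoc]; positivity
      have := hpos t ht
      split_ifs with h h' <;> first | exact le_rfl | exact hv | exact absurd (this h) h'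
    · have hv : t * |t| ^ q * f (K m + t) ≤ 0 := by
        rw [mul_assoc]; exact mul_nonpos_of_nonpos_of_nonneg ht h3
      have := hneg t ht
      split_ifs with h h' h' <;> first | exact le_rfl | exact hv | exact absurd (this h') h
  have le23 : ∀ t, f (L m) * u2 t ≤ f (K m) * u3 t := by
    intro t
    simp only [hu3, hu2, Set.indicator_apply]
    split_ifs with h
    · have hq : 0 ≤ |t| ^ q := Real.rpow_nonneg (abs_nonneg _) _
      rcases le_total 0 t with ht | ht
      · have := qlc_ratio hlc hf (L m) d t hd ht
        rw [← hKm] at this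
        have := mul_le_mul_of_nonneg_left this (mul_nonneg ht hq)
        linarith
      · have := qlc_ratio hlc hf (L m + t) d (-t) hd (by linarith)
        rw [show L m + t + d + -t = K m by rw [hKm]; ring, show L m + t + -t = L m by ring,
          show L m + t + d = K m + t by rw [hKm]; ring] at this
        have := mul_le_mul_of_nonneg_left this (mul_nonneg (neg_nonneg.2 ht) hq)
        linarith
    · simp
  have a1 : (0:ℝ) ≤ ∫ t, u2 t := by rw [← z1]; exact integral_mono i1 i2 le12
  have a2 : ∫ t, f (L m) * u2 t ≤ ∫ t, f (K m) * u3 t :=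
    integral_mono (i2.const_mul _) (i3.const_mul _) le23
  have z2 : ∫ t, u2 t = 0 := by
    rw [integral_const_mul, integral_const_mul, z3] at a2
    have := hLp m
    nlinarith
  have e12 : u1 =ᵐ[volume] u2 :=
    (integral_eq_iff_of_ae_le i1 i2 (Filter.Eventually.of_forall le12)).1 (z1.trans z2.symm)
  have e23 : (fun t => f (L m) * u2 t) =ᵐ[volume] fun t => f (K m) * u3 t :=
    (integral_eq_iff_of_ae_le (i2.const_mul _) (i3.const_mul _)
      (Filter.Eventually.of_forall le23)).1 (by
        rw [integral_const_mul, integral_const_mul, z2, z3]; simp)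
  have hval : ∀ t, t < 0 → 0 < f (K m + t) → t * |t| ^ q * f (K m + t) ≠ 0 := by
    intro t ht h
    have : 0 < |t| ^ q := Real.rpow_pos_of_pos (abs_pos.2 ht.ne) _
    exact mul_ne_zero (mul_ne_zero ht.ne this.ne') h.ne'
  by_cases h0 : ∃ j, j < m
  · -- predecessor
    have hpred : ∃ j : Fin n, j < m ∧ ∀ k, k < m → k ≤ j := by
      obtain ⟨j, hj⟩ := h0
      refine ⟨⟨m.1 - 1, by omega⟩, ?_, ?_⟩
      · rw [Fin.lt_def] at *; simp; omega
      · intro k hk; rw [Fin.lt_def] at *; rw [Fin.le_def]; simp; omega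
    obtain ⟨j, hj, hjm⟩ := hpred
    have hlt := hmin j hj
    refine ae_ne_interval e12 (a := (K j - K m) / 2) (b := (L j - L m) / 2) (by linarith) ?_
    intro t ht1 ht2
    have htn : t < 0 := by linarith [hL hj]
    have m1 : t ∈ qcell K m := by
      intro k
      rcases lt_trichotomy k m with hk | hk | hk
      · rw [abs_le_sub_of_neg (by linarith [hK hk])]
        have := hK.monotone (hjm k hk)
        linarith
      · subst hk; simp
      · rw [abs_le_sub_of_pos (by linarith [hK hk])]; linarith [hK hk]
    have m2 : t ∉ qcell L m := by
      intro h
      have := (abs_le_sub_of_neg (by linarith [hL hj])).1 (h j)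
      linarith
    rw [hu1, hu2, Set.indicator_of_mem m1, Set.indicator_of_notMem m2]
    exact hval t htn (qlc_pos hlc (a := K j) (b := K m) (by linarith [hK hj]) (by linarith) (hKp j) (hKp m))
  · push Not at h0
    have hbdd : BddBelow {x | 0 < f x} := ⟨0, fun x hx => by
      by_contra hc
      have := hsupp x (fun h => hc h.1)
      rw [Set.mem_ofPred_eq, this] at hx
      exact lt_irrefl _ hx⟩
    have hne : {x | 0 < f x}.Nonempty := ⟨_, hLp m⟩
    set α := sInf {x | 0 < f x} with hα
    have hαL : α ≤ L m := csInf_le hbdd (hLp m)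
    refine ae_ne_interval e23 (a := α - K m) (b := α - L m) (by linarith) ?_
    intro t ht1 ht2
    have htn : t < 0 := by linarith
    have m2 : t ∈ qcell L m := by
      intro k
      rcases eq_or_lt_of_le (h0 k) with hk | hk
      · subst hk; simp
      · rw [abs_le_sub_of_pos (by linarith [hL hk])]; linarith [hL hk]
    have hg : f (L m + t) = 0 := by
      by_contra hc
      have := csInf_le hbdd (show L m + t ∈ {x | 0 < f x} from lt_of_le_of_ne (hf _) (Ne.symm hc))
      linarith
    obtain ⟨a, ha, hat⟩ := exists_lt_of_csInf_lt hne (show sInf {x | 0 < f x} < K m + t by linarith)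
    have hh : 0 < f (K m + t) := qlc_pos hlc hat.le (by linarith) ha (hKp m)
    rw [hu2, hu3]
    simp only [Set.indicator_of_mem m2]
    rw [hg]
    simp only [mul_zero]
    exact mul_ne_zero (hLp m).ne' (hval t htn hh)

/-- The local quantization error. -/
noncomputable def qM (p : ℝ) {n : ℕ} (K : Fin n → ℝ) (x : ℝ) : ℝ := ⨅ j : Fin n, |x - K j| ^ p

/-- The Voronoi cell. -/
def qA {n : ℕ} (K : Fin n → ℝ) (i : Fin n) : Set ℝ := {y : ℝ | ∀ j : Fin n, |y - K i| ≤ |y - K j|}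

lemma qA_meas {n : ℕ} (K : Fin n → ℝ) (i : Fin n) : MeasurableSet (qA K i) := by
  have : qA K i = ⋂ j, {y | |y - K i| ≤ |y - K j|} := by
    ext; simp [qA]
  rw [this]
  exact (isClosed_iInter fun j => isClosed_le (by fun_prop) (by fun_prop)).measurableSet

lemma qM_cont {p : ℝ} (hp : 2 ≤ p) {n : ℕ} [Nonempty (Fin n)] :
    Continuous (Function.uncurry fun (K : Fin n → ℝ) (x : ℝ) => qM p K x) := by
  have : (Function.uncurry fun (K : Fin n → ℝ) (x : ℝ) => qM p K x) =
      fun a => Finset.univ.inf' Finset.univ_nonempty fun j => |a.2 - a.1 j| ^ p := by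
    funext a
    rw [Finset.inf'_univ_eq_ciInf]; rfl
  rw [this]
  apply Continuous.finset_inf'_apply
  intro i _
  exact Continuous.rpow_const (by fun_prop) (fun _ => Or.inr (by linarith))

lemma qM_cont' {p : ℝ} (hp : 2 ≤ p) {n : ℕ} [Nonempty (Fin n)] (K : Fin n → ℝ) :
    Continuous (qM p K) :=
  (qM_cont hp).comp (Continuous.prodMk_right K)

lemma qM_le {p : ℝ} {n : ℕ} (K : Fin n → ℝ) (x : ℝ) (j : Fin n) :
    qM p K x ≤ |x - K j| ^ p :=
  ciInf_le (Set.finite_range _).bddBelow j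

lemma qM_eq {p : ℝ} (hp : 2 ≤ p) {n : ℕ} [Nonempty (Fin n)] (K : Fin n → ℝ) (x : ℝ) (i : Fin n)
    (h : x ∈ qA K i) : qM p K x = |x - K i| ^ p := by
  apply le_antisymm (qM_le K x i)
  exact le_ciInf fun j => Real.rpow_le_rpow (abs_nonneg _) (h j) (by linarith)

lemma qM_mono {p : ℝ} (hp : 2 ≤ p) {n : ℕ} [Nonempty (Fin n)] (K K' : Fin n → ℝ) (x : ℝ)
    (h : ∀ j, ∃ k, |x - K' k| ≤ |x - K j|) : qM p K' x ≤ qM p K x := by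
  refine le_ciInf fun j => ?_
  obtain ⟨k, hk⟩ := h j
  exact (qM_le K' x k).trans (Real.rpow_le_rpow (abs_nonneg _) hk (by linarith))

lemma qint {μ : Measure ℝ} [IsProbabilityMeasure μ] {Kbar : ℝ}
    (hμ : ∀ᵐ x ∂μ, x ∈ Set.Icc (0:ℝ) Kbar) {g : ℝ → ℝ} (hg : Continuous g) : Integrable g μ := by
  have h := hg.continuousOn.integrableOn_compact (μ := μ) (isCompact_Icc (a := (0:ℝ)) (b := Kbar))
  rwa [IntegrableOn, Measure.restrict_eq_self_of_ae_mem hμ] at h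

lemma qopt_all {μ : Measure ℝ} {p : ℝ} {n : ℕ} {K : Fin n → ℝ}
    (h : ∀ K' : Fin n → ℝ, Monotone K' → ∫ x, qM p K x ∂μ ≤ ∫ x, qM p K' x ∂μ) (K' : Fin n → ℝ) :
    ∫ x, qM p K x ∂μ ≤ ∫ x, qM p K' x ∂μ := by
  have := h _ (Tuple.monotone_sort K')
  refine this.trans (le_of_eq ?_)
  congr 1
  funext x
  exact Equiv.iInf_comp (g := fun j => |x - K' j| ^ p) (Tuple.sort K')

lemma qimprove {μ : Measure ℝ} [IsProbabilityMeasure μ] [NullSingletonClass μ] {Kbar : ℝ}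
    (hμ : ∀ᵐ x ∂μ, x ∈ Set.Icc (0:ℝ) Kbar) {p : ℝ} (hp : 2 ≤ p) {n : ℕ} [Nonempty (Fin n)]
    {K : Fin n → ℝ} (hopt : ∀ K' : Fin n → ℝ, ∫ x, qM p K x ∂μ ≤ ∫ x, qM p K' x ∂μ) (i : Fin n)
    (h : ∀ᵐ x ∂μ, ∃ j, j ≠ i ∧ |x - K j| ≤ |x - K i|) : False := by
  have hr : μ (Set.range K)ᶜ ≠ 0 := by
    have h0 : μ (Set.range K) = 0 := (Set.finite_range K).measure_zero μ
    rw [prob_compl_eq_one_sub (Set.finite_range K).measurableSet, h0]; simp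
  obtain ⟨y, hy, hy'⟩ := exists_mem_forall_mem_nhdsWithin_pos_measure hr
  have hle : qM p (Function.update K i y) ≤ᵐ[μ] qM p K := by
    filter_upwards [h] with x hx
    apply qM_mono hp
    intro j
    by_cases hj : j = i
    · obtain ⟨k, hk, hk'⟩ := hx
      refine ⟨k, ?_⟩
      rw [Function.update_of_ne hk, hj]; exact hk'
    · exact ⟨j, by rw [Function.update_of_ne hj]⟩
  have i1 := qint hμ (qM_cont' hp (Function.update K i y))
  have i2 := qint hμ (qM_cont' hp K)
  have heq := (integral_eq_iff_of_ae_le i1 i2 hle).1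
    (le_antisymm (integral_mono_ae i1 i2 hle) (hopt _))
  have h0 : μ {x | ¬ qM p (Function.update K i y) x = qM p K x} = 0 := heq
  have hopen : IsOpen {x | ∀ j, |x - y| < |x - K j|} := by
    have : {x | ∀ j, |x - y| < |x - K j|} = ⋂ j, {x | |x - y| < |x - K j|} := by ext; simp
    rw [this]
    exact isOpen_iInter_of_finite fun j => isOpen_lt (by fun_prop) (by fun_prop)
  have hmem : {x | ∀ j, |x - y| < |x - K j|} ∈ nhds y := by
    apply hopen.mem_nhds
    intro j
    simp only [sub_self, abs_zero, abs_pos]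
    intro hc
    exact hy ⟨j, by linarith⟩
  have hpos := hy' _ (mem_nhdsWithin_of_mem_nhds hmem)
  have : μ {x | ∀ j, |x - y| < |x - K j|} ≤ μ {x | ¬ qM p (Function.update K i y) x = qM p K x} := by
    apply measure_mono
    intro x hx hc
    obtain ⟨j, hj⟩ := exists_eq_ciInf_of_finite (f := fun j => |x - K j| ^ p)
    have h1 := qM_le (p := p) (Function.update K i y) x i
    rw [Function.update_self] at h1
    have h2 : |x - y| ^ p < |x - K j| ^ p := Real.rpow_lt_rpow (abs_nonneg _) (hx j) (by linarith)
    have h3 : |x - K j| ^ p = qM p K x := hj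
    rw [h3, ← hc] at h2
    linarith
  rw [h0] at this
  exact absurd hpos (not_lt.2 this)

lemma qw_cont {p : ℝ} (hp : 2 ≤ p) (c : ℝ) : Continuous fun x : ℝ => |x - c| ^ (p - 2) :=
  Continuous.rpow_const (by fun_prop) (fun _ => Or.inr (by linarith))

lemma qfix {μ : Measure ℝ} [IsProbabilityMeasure μ] {Kbar : ℝ}
    (hμ : ∀ᵐ x ∂μ, x ∈ Set.Icc (0:ℝ) Kbar) {p : ℝ} (hp : 2 ≤ p) {n : ℕ} [Nonempty (Fin n)]
    {K : Fin n → ℝ} (hopt : ∀ K' : Fin n → ℝ, ∫ x, qM p K x ∂μ ≤ ∫ x, qM p K' x ∂μ) (i : Fin n) :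
    ∫ x in qA K i, (x - K i) * |x - K i| ^ (p - 2) ∂μ = 0 := by
  have hpc : ∀ y : ℝ, Continuous fun x : ℝ => |x - y| ^ p := fun y =>
    Continuous.rpow_const (by fun_prop) (fun _ => Or.inr (by linarith))
  have hmin : ∀ y, ∫ x in qA K i, |x - K i| ^ p ∂μ ≤ ∫ x in qA K i, |x - y| ^ p ∂μ := by
    intro y
    have h1 := hopt (Function.update K i y)
    have iK := qint hμ (qM_cont' hp K)
    have iU := qint hμ (qM_cont' hp (Function.update K i y))
    rw [← integral_add_compl (qA_meas K i) iK, ← integral_add_compl (qA_meas K i) iU] at h1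
    have e1 : ∫ x in qA K i, qM p K x ∂μ = ∫ x in qA K i, |x - K i| ^ p ∂μ :=
      setIntegral_congr_fun (qA_meas K i) fun x hx => qM_eq hp K x i hx
    have e2 : ∫ x in qA K i, qM p (Function.update K i y) x ∂μ ≤ ∫ x in qA K i, |x - y| ^ p ∂μ := by
      apply setIntegral_mono iU.integrableOn (qint hμ (hpc y)).integrableOn
      intro x
      have := qM_le (p := p) (Function.update K i y) x i
      rwa [Function.update_self] at this
    have e3 : ∫ x in (qA K i)ᶜ, qM p (Function.update K i y) x ∂μ ≤ ∫ x in (qA K i)ᶜ, qM p K x ∂μ := by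
      apply setIntegral_mono_on iU.integrableOn iK.integrableOn (qA_meas K i).compl
      intro x hx
      apply qM_mono hp
      intro j
      by_cases hj : j = i
      · have : ∃ k, |x - K k| < |x - K i| := by
          by_contra hc
          push Not at hc
          exact hx hc
        obtain ⟨k, hk⟩ := this
        have hki : k ≠ i := fun h => by rw [h] at hk; exact lt_irrefl _ hk
        exact ⟨k, by rw [Function.update_of_ne hki, hj]; exact hk.le⟩
      · exact ⟨j, by rw [Function.update_of_ne hj]⟩
    linarith
  have hder : HasDerivAt (fun y => ∫ x in qA K i, |x - y| ^ p ∂μ)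
      (∫ x in qA K i, -(p * |x - K i| ^ (p - 2) * (x - K i)) ∂μ) (K i) := by
    set C := Kbar + |K i| + 1
    refine (hasDerivAt_integral_of_dominated_loc_of_deriv_le
      (F' := fun y x => -(p * |x - y| ^ (p - 2) * (x - y)))
      (bound := fun _ => p * C ^ (p - 2) * C) (Metric.ball_mem_nhds (K i) one_pos) ?_ ?_ ?_ ?_ ?_ ?_).2
    · exact Filter.Eventually.of_forall fun y => (hpc y).aestronglyMeasurable
    · exact (qint hμ (hpc _)).integrableOn
    · have := qw_cont hp (K i)
      exact Continuous.aestronglyMeasurable (by fun_prop)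
    · filter_upwards [ae_restrict_of_ae hμ] with x hx y hy
      rw [Metric.mem_ball, Real.dist_eq] at hy
      have hxy : |x - y| ≤ C := by
        have h1 := abs_lt.1 hy
        have h2 := neg_abs_le (K i)
        have h3 := le_abs_self (K i)
        rw [abs_le]
        constructor <;> simp only [C] <;> linarith [hx.1, hx.2]
      have hC : 0 ≤ C := (abs_nonneg _).trans hxy
      rw [norm_neg, norm_mul, norm_mul, Real.norm_eq_abs, Real.norm_eq_abs, Real.norm_eq_abs,
        abs_of_nonneg (by linarith : 0 ≤ p), abs_of_nonneg (Real.rpow_nonneg (abs_nonneg _) _)]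
      have h4 : |x - y| ^ (p - 2) ≤ C ^ (p - 2) :=
        Real.rpow_le_rpow (abs_nonneg _) hxy (by linarith)
      gcongr
    · exact integrable_const _
    · filter_upwards with x y _
      have h1 := hasDerivAt_abs_rpow (x - y) (p := p) (by linarith)
      have h2 : HasDerivAt (fun y => x - y) (-1) y := by
        simpa using (hasDerivAt_id y).const_sub x
      have := h1.comp y h2
      simpa [Function.comp_def] using this
  have hloc : IsLocalMin (fun y => ∫ x in qA K i, |x - y| ^ p ∂μ) (K i) :=
    Filter.Eventually.of_forall hmin
  have h0 := hloc.hasDerivAt_eq_zero hder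
  have e : (fun x => -(p * |x - K i| ^ (p - 2) * (x - K i))) =
      fun x => (-p) * ((x - K i) * |x - K i| ^ (p - 2)) := by funext x; ring
  rw [e, integral_const_mul] at h0
  rcases mul_eq_zero.1 h0 with h | h
  · linarith
  · exact h

lemma qexists {μ : Measure ℝ} [IsProbabilityMeasure μ] {Kbar : ℝ} (hKbar : 0 < Kbar)
    (hμ : ∀ᵐ x ∂μ, x ∈ Set.Icc (0:ℝ) Kbar) {p : ℝ} (hp : 2 ≤ p) {n : ℕ} [Nonempty (Fin n)] :
    ∃ M : Fin n → ℝ, Monotone M ∧ ∀ K' : Fin n → ℝ, ∫ x, qM p M x ∂μ ≤ ∫ x, qM p K' x ∂μ := by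
  have hc : Continuous fun K : Fin n → ℝ => ∫ x, qM p K x ∂μ := by
    have := continuous_parametric_integral_of_continuous (μ := μ) (qM_cont hp (n := n))
      (isCompact_Icc (a := (0:ℝ)) (b := Kbar))
    rwa [Measure.restrict_eq_self_of_ae_mem hμ] at this
  have hcomp : IsCompact (Set.pi Set.univ fun _ : Fin n => Set.Icc (0:ℝ) Kbar) :=
    isCompact_univ_pi fun _ => isCompact_Icc
  obtain ⟨M, -, hM⟩ := hcomp.exists_isMinOn ⟨fun _ => 0, fun _ _ => ⟨le_rfl, hKbar.le⟩⟩ hc.continuousOn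
  have hall : ∀ K' : Fin n → ℝ, ∫ x, qM p M x ∂μ ≤ ∫ x, qM p K' x ∂μ := by
    intro K'
    let P : Fin n → ℝ := fun j => max 0 (min (K' j) Kbar)
    have hP : P ∈ Set.pi Set.univ fun _ : Fin n => Set.Icc (0:ℝ) Kbar := by
      intro j _
      exact ⟨le_max_left _ _, max_le hKbar.le (min_le_right _ _)⟩
    refine (hM hP).trans ?_
    apply integral_mono_ae (qint hμ (qM_cont' hp P)) (qint hμ (qM_cont' hp K'))
    filter_upwards [hμ] with x hx
    apply qM_mono hp
    intro j
    refine ⟨j, ?_⟩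
    have h1 := hx.1
    have h2 := hx.2
    simp only [P]
    rcases le_total (K' j) Kbar with a | a
    · rw [min_eq_left a]
      rcases le_total 0 (K' j) with b | b
      · rw [max_eq_right b]
      · rw [max_eq_left b, abs_of_nonneg (by linarith), abs_of_nonneg (by linarith)]; linarith
    · rw [min_eq_right a, max_eq_right hKbar.le, abs_of_nonpos (by linarith),
        abs_of_nonpos (by linarith)]; linarith
  refine ⟨M ∘ Tuple.sort M, Tuple.monotone_sort M, fun K' => ?_⟩
  refine (le_of_eq ?_).trans (hall K')
  congr 1
  funext x
  exact Equiv.iInf_comp (g := fun j => |x - M j| ^ p) (Tuple.sort M)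

lemma qpos_iff {μ : Measure ℝ} [IsProbabilityMeasure μ] [NullSingletonClass μ] {Kbar : ℝ}
    (hμ : ∀ᵐ x ∂μ, x ∈ Set.Icc (0:ℝ) Kbar) {p : ℝ} (hp : 2 ≤ p) {n : ℕ}
    (K : Fin n → ℝ) (i : Fin n) :
    0 < ∫ x in qA K i, |x - K i| ^ (p - 2) ∂μ ↔ μ (qA K i) ≠ 0 := by
  rw [setIntegral_pos_iff_support_of_nonneg_ae
    (Filter.Eventually.of_forall fun x => Real.rpow_nonneg (abs_nonneg _) _)
    (qint hμ (qw_cont hp (K i))).integrableOn, pos_iff_ne_zero]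
  have : μ (Function.support (fun x => |x - K i| ^ (p - 2)) ∩ qA K i) = μ (qA K i) := by
    apply measure_congr
    have : ∀ᵐ x ∂μ, x ≠ K i := by
      have : μ {K i} = 0 := measure_singleton _
      rw [ae_iff]; simpa using this
    filter_upwards [this] with x hx
    have h1 : |x - K i| ^ (p - 2) ≠ 0 :=
      (Real.rpow_pos_of_pos (abs_pos.2 (sub_ne_zero.2 hx)) _).ne'
    apply propext
    change (|x - K i| ^ (p - 2) ≠ 0 ∧ x ∈ qA K i) ↔ x ∈ qA K i
    simp [h1]
  rw [this]

lemma qfp_iff {μ : Measure ℝ} [IsProbabilityMeasure μ] [NullSingletonClass μ] {Kbar : ℝ}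
    (hμ : ∀ᵐ x ∂μ, x ∈ Set.Icc (0:ℝ) Kbar) {p : ℝ} (hp : 2 ≤ p) {n : ℕ}
    (K : Fin n → ℝ) (i : Fin n) :
    (0 < ∫ x in qA K i, |x - K i| ^ (p - 2) ∂μ ∧
      K i = (∫ x in qA K i, x * |x - K i| ^ (p - 2) ∂μ) / ∫ x in qA K i, |x - K i| ^ (p - 2) ∂μ) ↔
    (μ (qA K i) ≠ 0 ∧ ∫ x in qA K i, (x - K i) * |x - K i| ^ (p - 2) ∂μ = 0) := by
  rw [← qpos_iff hμ hp]
  apply and_congr_right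
  intro h
  have hc := qw_cont hp (K i)
  have e : ∫ x in qA K i, (x - K i) * |x - K i| ^ (p - 2) ∂μ =
      ∫ x in qA K i, x * |x - K i| ^ (p - 2) ∂μ - K i * ∫ x in qA K i, |x - K i| ^ (p - 2) ∂μ := by
    rw [← integral_const_mul, ← integral_sub]
    · congr 1; funext x; ring
    · exact (qint hμ (by fun_prop)).integrableOn
    · exact (qint hμ (by fun_prop)).integrableOn
  rw [e, eq_div_iff h.ne', sub_eq_zero, eq_comm]

lemma qfp_pos {f : ℝ → ℝ} (hlc : QLC f) (hf : ∀ x, 0 ≤ f x) {μ : Measure ℝ}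
    [IsProbabilityMeasure μ] [NullSingletonClass μ]
    (hfpos : ∀ᵐ x ∂μ, 0 < f x) {Kbar : ℝ}
    (hμ : ∀ᵐ x ∂μ, x ∈ Set.Icc (0:ℝ) Kbar) {p : ℝ} (hp : 2 ≤ p) {n : ℕ}
    (K : Fin n → ℝ) (i : Fin n) (h0 : μ (qA K i) ≠ 0)
    (h1 : ∫ x in qA K i, (x - K i) * |x - K i| ^ (p - 2) ∂μ = 0) : 0 < f (K i) := by
  have hc := qw_cont hp (K i)
  have hI : IntegrableOn (fun x => (x - K i) * |x - K i| ^ (p - 2)) (qA K i) μ :=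
    (qint hμ (by fun_prop)).integrableOn
  have hne : ∀ᵐ x ∂(μ.restrict (qA K i)), x ≠ K i := by
    apply ae_restrict_of_ae
    have : μ {K i} = 0 := measure_singleton _
    rw [ae_iff]; simpa using this
  have hw : ∀ x, x ≠ K i → 0 < |x - K i| ^ (p - 2) := fun x hx =>
    Real.rpow_pos_of_pos (abs_pos.2 (sub_ne_zero.2 hx)) _
  have hbad : ¬ ∀ᵐ x ∂(μ.restrict (qA K i)), (x - K i) * |x - K i| ^ (p - 2) = 0 := by
    intro h
    have : ∀ᵐ x ∂(μ.restrict (qA K i)), False := by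
      filter_upwards [h, hne] with x hx hx'
      exact mul_ne_zero (sub_ne_zero.2 hx') (hw x hx').ne' hx
    rw [Filter.eventually_false_iff_eq_bot, ae_eq_bot, Measure.restrict_eq_zero] at this
    exact h0 this
  have hr := ae_restrict_of_ae (s := qA K i) hfpos
  have hright : ∃ b, K i < b ∧ 0 < f b := by
    by_contra hcon
    push Not at hcon
    have hle : ∀ᵐ x ∂(μ.restrict (qA K i)), (x - K i) * |x - K i| ^ (p - 2) ≤ 0 := by
      filter_upwards [hr] with x hx
      have : x ≤ K i := by
        by_contra hc
        exact absurd hx (not_lt.2 (hcon x (not_le.1 hc)))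
      exact mul_nonpos_of_nonpos_of_nonneg (by linarith) (Real.rpow_nonneg (abs_nonneg _) _)
    exact hbad ((integral_eq_iff_of_ae_le hI (integrable_zero _ _ _) hle).1 (by simpa using h1))
  have hleft : ∃ a, a < K i ∧ 0 < f a := by
    by_contra hcon
    push Not at hcon
    have hle : ∀ᵐ x ∂(μ.restrict (qA K i)), 0 ≤ (x - K i) * |x - K i| ^ (p - 2) := by
      filter_upwards [hr] with x hx
      have : K i ≤ x := by
        by_contra hc
        exact absurd hx (not_lt.2 (hcon x (not_le.1 hc)))
      exact mul_nonneg (by linarith) (Real.rpow_nonneg (abs_nonneg _) _)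
    exact hbad ((integral_eq_zero_iff_of_nonneg_ae hle hI).1 h1)
  obtain ⟨b, hb, hb'⟩ := hright
  obtain ⟨a, ha, ha'⟩ := hleft
  exact qlc_pos hlc ha.le hb.le ha' hb'

theorem quantization_solution_iff_lloyd_fixed_point
    (p : ℝ) (hp : 2 ≤ p) (n : ℕ) (hn : 2 ≤ n)
    (f : ℝ → ℝ) (hf_nonneg : ∀ x, 0 ≤ f x)
    (hf_logconcave : ∀ x y t : ℝ, 0 ≤ t → t ≤ 1 →
      f x ^ t * f y ^ (1 - t) ≤ f (t * x + (1 - t) * y))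
    (Kbar : ℝ) (hKbar : 0 < Kbar)
    (hf_supp : ∀ x : ℝ, x ∉ Set.Icc (0 : ℝ) Kbar → f x = 0)
    (μ : Measure ℝ) [IsProbabilityMeasure μ]
    (hμ : μ = volume.withDensity fun x => ENNReal.ofReal (f x))
    (F : (Fin n → ℝ) → ℝ)
    (hF : ∀ K : Fin n → ℝ, F K = ∫ x, (⨅ j : Fin n, |x - K j| ^ p) ∂μ)
    (K : Fin n → ℝ) (hK : StrictMono K) :
    (∀ K' : Fin n → ℝ, Monotone K' → F K ≤ F K')
      ↔ ∀ i : Fin n,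
          0 < (∫ x in {y : ℝ | ∀ j : Fin n, |y - K i| ≤ |y - K j|},
                |x - K i| ^ (p - 2) ∂μ)
          ∧ K i = (∫ x in {y : ℝ | ∀ j : Fin n, |y - K i| ≤ |y - K j|},
                    x * |x - K i| ^ (p - 2) ∂μ)
                  / (∫ x in {y : ℝ | ∀ j : Fin n, |y - K i| ≤ |y - K j|},
                    |x - K i| ^ (p - 2) ∂μ) := by
  have hlc : QLC f := hf_logconcave
  have hfm : Measurable f := qlc_measurable hlc hf_nonneg
  have hdm : Measurable fun x => ENNReal.ofReal (f x) := hfm.ennreal_ofReal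
  have : Nonempty (Fin n) := ⟨⟨0, by omega⟩⟩
  have : NullSingletonClass μ := ⟨fun x => by
    rw [hμ]; exact withDensity_absolutelyContinuous _ _ (measure_singleton x)⟩
  have hfpos : ∀ᵐ x ∂μ, 0 < f x := by
    rw [hμ, ae_withDensity_iff hdm]
    filter_upwards with x hx
    by_contra hc
    exact hx (ENNReal.ofReal_eq_zero.2 (not_lt.1 hc))
  have hsup : ∀ᵐ x ∂μ, x ∈ Set.Icc (0:ℝ) Kbar := by
    filter_upwards [hfpos] with x hx
    by_contra hc
    exact hx.ne' (hf_supp x hc)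
  have hF' : ∀ K, F K = ∫ x, qM p K x ∂μ := hF
  have hfwd : ∀ K : Fin n → ℝ, (∀ K' : Fin n → ℝ, ∫ x, qM p K x ∂μ ≤ ∫ x, qM p K' x ∂μ) → ∀ i,
      (μ (qA K i) ≠ 0 ∧ ∫ x in qA K i, (x - K i) * |x - K i| ^ (p - 2) ∂μ = 0) := by
    intro K hopt i
    refine ⟨fun h0 => ?_, qfix hsup hp hopt i⟩
    apply qimprove hsup hp hopt i
    have : ∀ᵐ x ∂μ, x ∉ qA K i := measure_eq_zero_iff_ae_notMem.1 h0
    filter_upwards [this] with x hx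
    by_contra hc
    push Not at hc
    apply hx
    intro j
    by_cases hj : j = i
    · rw [hj]
    · exact (hc j hj).le
  change _ ↔ ∀ i : Fin n, (0 < ∫ x in qA K i, |x - K i| ^ (p - 2) ∂μ ∧
      K i = (∫ x in qA K i, x * |x - K i| ^ (p - 2) ∂μ) / ∫ x in qA K i, |x - K i| ^ (p - 2) ∂μ)
  simp only [qfp_iff hsup hp, hF']
  constructor
  · intro h
    exact hfwd K (qopt_all h)
  · intro hfix K' _
    obtain ⟨M, hMmono, hM⟩ := qexists (n := n) hKbar hsup hp
    have hMs : StrictMono M := by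
      apply hMmono.strictMono_of_injective
      intro a b hab
      by_contra hne
      apply qimprove hsup hp hM a
      filter_upwards with x
      exact ⟨b, fun h => hne h.symm, by rw [hab]⟩
    have hMfix := hfwd M hM
    have hI : ∀ (c : ℝ) (S : Set ℝ), MeasurableSet S →
        Integrable (S.indicator fun t => t * |t| ^ (p - 2) * f (c + t)) volume := by
      intro c S hS
      apply Integrable.indicator _ hS
      have hc := qw_cont hp c
      have h1 : Integrable (fun x => (x - c) * |x - c| ^ (p - 2)) μ := qint hsup (by fun_prop)
      rw [hμ, integrable_withDensity_iff_integrable_smul₀' hdm.aemeasurable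
        (Filter.Eventually.of_forall fun _ => ENNReal.ofReal_lt_top)] at h1
      have h2 := h1.comp_add_left c
      refine h2.congr (Filter.Eventually.of_forall fun t => ?_)
      simp only [ENNReal.toReal_ofReal (hf_nonneg _), smul_eq_mul, add_sub_cancel_left]
      ring
    have hconv : ∀ K : Fin n → ℝ, ∀ i, ∫ x in qA K i, (x - K i) * |x - K i| ^ (p - 2) ∂μ = 0 →
        ∫ t, (qcell K i).indicator (fun t => t * |t| ^ (p - 2) * f (K i + t)) t = 0 := by
      intro K i h
      rw [hμ, setIntegral_withDensity_eq_setIntegral_toReal_smul₀ hdm.aemeasurable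
        (Filter.Eventually.of_forall fun _ => ENNReal.ofReal_lt_top) _ (qA_meas K i),
        ← integral_indicator (qA_meas K i), ← integral_add_left_eq_self _ (K i)] at h
      rw [← h]
      congr 1
      funext t
      have hiff : t ∈ qcell K i ↔ K i + t ∈ qA K i := by
        apply forall_congr'
        intro j
        rw [add_sub_cancel_left, show K i + t - K j = t - (K j - K i) by ring]
      by_cases ht : t ∈ qcell K i
      · rw [Set.indicator_of_mem ht, Set.indicator_of_mem (hiff.1 ht)]
        simp only [ENNReal.toReal_ofReal (hf_nonneg _), smul_eq_mul, add_sub_cancel_left]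
        ring
      · rw [Set.indicator_of_notMem ht, Set.indicator_of_notMem (fun h => ht (hiff.2 h))]
    have hKp : ∀ i, 0 < f (K i) := fun i =>
      qfp_pos hlc hf_nonneg hfpos hsup hp K i (hfix i).1 (hfix i).2
    have hMp : ∀ i, 0 < f (M i) := fun i =>
      qfp_pos hlc hf_nonneg hfpos hsup hp M i (hMfix i).1 (hMfix i).2
    have hKM : K = M := by
      funext i
      apply le_antisymm
      · exact qcompare hlc hf_nonneg hf_supp hK hMs hI hKp hMp
          (fun i => hconv K i (hfix i).2) (fun i => hconv M i (hMfix i).2) i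
      · exact qcompare hlc hf_nonneg hf_supp hMs hK hI hMp hKp
          (fun i => hconv M i (hMfix i).2) (fun i => hconv K i (hfix i).2) i
    rw [hKM]
    exact hM K'
end

section
/- Let γ > 0, σ > 0, C > 0, A > 0, f ∈ ℝ and z ∈ ℝ. Then sup_{δ ∈ ℝ} γ^{−1} (1 − exp(−γ(z + δ))) · A exp(−(C/σ)(δ + f)) = (A/γ) · (1 − (1 + σγ/C)^{−1}) · (1 + σγ/C)^{−C/(σγ)} · exp((C/σ)(z − f)), and this supremum is attained at δ* = −z + γ^{−1} log(1 + σγ/C). -/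
/-- **Explicit supremum of the market maker's Hamiltonian integrand.**
Let `γ, σ, C, A > 0` and `f, z ∈ ℝ`. Then
`sup_δ γ⁻¹ (1 − exp(−γ(z + δ))) · A exp(−(C/σ)(δ + f))
  = (A/γ)(1 − (1 + σγ/C)⁻¹)(1 + σγ/C)^{−C/(σγ)} exp((C/σ)(z − f))`,
attained at `δ* = −z + γ⁻¹ log(1 + σγ/C)`. -/
theorem hamiltonian_integrand_sup_value
    (γ σ C A : ℝ) (hγ : 0 < γ) (hσ : 0 < σ) (hC : 0 < C) (hA : 0 < A)
    (f z : ℝ)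
    (h : ℝ → ℝ)
    (hh : ∀ δ : ℝ, h δ = γ⁻¹ * (1 - Real.exp (-γ * (z + δ)))
      * (A * Real.exp (-(C / σ) * (δ + f))))
    (δstar : ℝ) (hδstar : δstar = -z + γ⁻¹ * Real.log (1 + σ * γ / C))
    (V : ℝ)
    (hV : V = A / γ * (1 - (1 + σ * γ / C)⁻¹) * (1 + σ * γ / C) ^ (-(C / (σ * γ)))
      * Real.exp (C / σ * (z - f))) :
    (⨆ δ : ℝ, h δ) = V ∧ (∀ δ : ℝ, h δ ≤ V) ∧ h δstar = V := by
  have hq : 0 < 1 + σ * γ / C := by positivity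
  have hr : (1 + σ * γ / C)⁻¹ = C / (C + σ * γ) := by field_simp
  have key : ∀ w : ℝ, h (δstar + w) = A / γ * ((1 - (1 + σ * γ / C)⁻¹ * Real.exp (-γ * w))
      * Real.exp (-(C / σ) * w)) * (1 + σ * γ / C) ^ (-(C / (σ * γ)))
      * Real.exp (C / σ * (z - f)) := by
    intro w
    rw [hh, hδstar, Real.rpow_def_of_pos hq]
    have e1 : Real.exp (-γ * (z + (-z + γ⁻¹ * Real.log (1 + σ * γ / C) + w)))
        = (1 + σ * γ / C)⁻¹ * Real.exp (-γ * w) := by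
      rw [← Real.exp_log (inv_pos.mpr hq), ← Real.exp_add, Real.log_inv]
      congr 1
      field_simp
      ring
    have e2 : Real.exp (-(C / σ) * (-z + γ⁻¹ * Real.log (1 + σ * γ / C) + w + f))
        = Real.exp (-(C / σ) * w) * Real.exp (Real.log (1 + σ * γ / C) * (-(C / (σ * γ))))
          * Real.exp (C / σ * (z - f)) := by
      rw [← Real.exp_add, ← Real.exp_add]
      congr 1
      generalize Real.log (1 + σ * γ / C) = L
      field_simp
      ring
    rw [e1, e2]
    ring
  have hstar : h δstar = V := by
    have := key 0
    simp only [add_zero, mul_zero, Real.exp_zero, mul_one] at this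
    rw [this, hV]
  have hle : ∀ δ : ℝ, h δ ≤ V := by
    intro δ
    have hk := key (δ - δstar)
    rw [add_sub_cancel] at hk
    rw [hk, hV]
    generalize δ - δstar = w
    have main : (1 - (1 + σ * γ / C)⁻¹ * Real.exp (-γ * w)) * Real.exp (-(C / σ) * w)
        ≤ 1 - (1 + σ * γ / C)⁻¹ := by
      rw [hr]
      have a1 := Real.add_one_le_exp (C / σ * w)
      have a2 := Real.add_one_le_exp (-γ * w)
      have hE : Real.exp (-(C / σ) * w) = (Real.exp (C / σ * w))⁻¹ := by
        rw [← Real.exp_neg]; congr 1; ring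
      rw [hE, ← div_eq_mul_inv, div_le_iff₀ (Real.exp_pos _)]
      have a3 : σ * γ * (C / σ * w + 1) ≤ σ * γ * Real.exp (C / σ * w) :=
        mul_le_mul_of_nonneg_left a1 (by positivity)
      have a4 : C * (-γ * w + 1) ≤ C * Real.exp (-γ * w) :=
        mul_le_mul_of_nonneg_left a2 hC.le
      have a5 : σ * γ * (C / σ * w + 1) = C * γ * w + σ * γ := by field_simp
      have hD : 0 < C + σ * γ := by positivity
      have a6 : 1 - C / (C + σ * γ) = σ * γ / (C + σ * γ) := by field_simp; ring
      generalize Real.exp (C / σ * w) = X at *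
      generalize Real.exp (-γ * w) = Y at *
      have a7 : 1 - C / (C + σ * γ) * Y = (C + σ * γ - C * Y) / (C + σ * γ) := by field_simp
      rw [a6, a7, div_mul_eq_mul_div]
      apply div_le_div_of_nonneg_right _ hD.le
      linarith
    gcongr
  refine ⟨?_, hle, hstar⟩
  apply le_antisymm (ciSup_le hle)
  rw [← hstar]
  exact le_ciSup (f := h) ⟨V, by rintro _ ⟨δ, rfl⟩; exact hle δ⟩ δstar
end
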